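/- (Lemma 1, one-dimensional approximation by Walsh polynomials) For any 0 < ε < 1, any integer N_0 > 2, and any step function f(x) = ∑_{s=1}^q γ_s χ_{Δ_s}(x) where each Δ_s is a dyadic interval [(i−1)/2^m, i/2^m], there exist a measurable set E ⊆ [0,1] with |E| > 1 − ε and a Walsh polynomial P(x) = ∑_{k=N_0}^N c_k W_k(x) such that: (1) P(x) = f(x) on E; (2) ∑_{k=N_0}^N |c_k|^{2+ε} < ε; and (3) for every measurable subset e ⊆ E, max_{N_0 ≤ m < N} ∫_e |∑_{k=N_0}^m c_k W_k(x)| dx < ε + ∫_e |f(x)| dx. -/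

import Mathlib

open MeasureTheory Real
open scoped ENNReal Classical

/-- The basic Rademacher function: 1-periodic, equal to `1` on `[0,1/2)` and `-1` on `[1/2,1)`. -/
noncomputable def rad0 (x : ℝ) : ℝ := if Int.fract x < 1/2 then 1 else -1

/-- The Rademacher functions `r_k(x) = r_0(2^k x)`. -/
noncomputable def rad (k : ℕ) (x : ℝ) : ℝ := rad0 (2 ^ k * x)

/-- The Walsh–Paley functions: `W_n = ∏ r_m` over the binary digits `m` of `n`. -/
noncomputable def walsh (n : ℕ) (x : ℝ) : ℝ :=
  ∏ m ∈ Finset.range (n + 1), if n.testBit m then rad m x else 1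

/-- The unit square `T = [0,1]²`. -/
def T : Set (ℝ × ℝ) := Set.Icc (0:ℝ) 1 ×ˢ Set.Icc (0:ℝ) 1

lemma walsh_eq (n L : ℕ) (h : n < 2 ^ L) (x : ℝ) :
    walsh n x = ∏ i ∈ Finset.range L, if n.testBit i then rad i x else 1 := by
  have key : ∀ K L' : ℕ, K ≤ L' → n < 2 ^ K →
      ∏ i ∈ Finset.range L', (if n.testBit i then rad i x else 1) =
      ∏ i ∈ Finset.range K, (if n.testBit i then rad i x else 1) := by
    intro K L' hK hn
    symm
    apply Finset.prod_subset
    · intro a; simp only [Finset.mem_range]; omega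
    · intro a _ ha
      rw [Finset.mem_range, not_lt] at ha
      have : n.testBit a = false :=
        Nat.testBit_lt_two_pow (lt_of_lt_of_le hn (Nat.pow_le_pow_right (by norm_num) ha))
      simp [this]
  unfold walsh
  have h1 : n < 2 ^ (n + 1) := lt_trans (Nat.lt_succ_self n) (Nat.lt_two_pow_self)
  rcases le_total (n + 1) L with hl | hl
  · exact (key _ _ hl h1).symm
  · exact key _ _ hl h

lemma rad_add (s i : ℕ) (x : ℝ) : rad (s + i) x = rad i (2 ^ s * x) := by
  unfold rad; congr 1; ring

lemma walsh_add_mul (s k l : ℕ) (h : k < 2 ^ s) (x : ℝ) :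
    walsh (k + 2 ^ s * l) x = walsh k x * walsh l (2 ^ s * x) := by
  have hl : l < 2 ^ l := Nat.lt_two_pow_self
  have hb : k + 2 ^ s * l < 2 ^ (s + l) := by
    rw [pow_add]
    calc k + 2 ^ s * l < 2 ^ s + 2 ^ s * l := by omega
      _ = 2 ^ s * (l + 1) := by ring
      _ ≤ _ := Nat.mul_le_mul_left _ hl
  rw [walsh_eq _ _ hb, walsh_eq _ _ h, walsh_eq _ _ hl, Finset.prod_range_add]
  congr 1
  · apply Finset.prod_congr rfl
    intro i hi
    rw [Finset.mem_range] at hi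
    rw [add_comm k, Nat.testBit_two_pow_mul_add _ h]
    simp [hi]
  · apply Finset.prod_congr rfl
    intro i hi
    rw [add_comm k, Nat.testBit_two_pow_mul_add _ h, rad_add]
    simp

lemma walsh_zero (x : ℝ) : walsh 0 x = 1 := by
  rw [walsh_eq 0 0 (by norm_num)]; simp

lemma walsh_one (x : ℝ) : walsh 1 x = rad0 x := by
  rw [walsh_eq 1 1 (by norm_num)]; simp [rad]

lemma rad0_cases (x : ℝ) : rad0 x = 1 ∨ rad0 x = -1 := by
  unfold rad0; split_ifs <;> simp

lemma abs_walsh (n : ℕ) (x : ℝ) : |walsh n x| = 1 := by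
  unfold walsh
  rw [Finset.abs_prod]
  apply Finset.prod_eq_one
  intro i _
  split_ifs
  · unfold rad
    rcases rad0_cases (2 ^ i * x) with h | h <;> simp [h]
  · simp

lemma measurable_walsh (n : ℕ) : Measurable (walsh n) := by
  unfold walsh
  apply Finset.measurable_fun_prod
  intro i _
  split_ifs
  · unfold rad rad0
    apply Measurable.ite
    · exact measurableSet_lt (measurable_fract.comp (measurable_const.mul measurable_id)) measurable_const
    · exact measurable_const
    · exact measurable_const
  · exact measurable_const

lemma walsh_periodic (n : ℕ) : Function.Periodic (walsh n) 1 := by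
  intro x
  unfold walsh
  apply Finset.prod_congr rfl
  intro i _
  have : rad i (x + 1) = rad i x := by
    unfold rad rad0
    have : (2:ℝ) ^ i * (x + 1) = 2 ^ i * x + ((2 ^ i : ℕ) : ℝ) := by push_cast; ring
    rw [this, Int.fract_add_natCast]
  rw [this]

lemma intervalIntegrable_ww (a b : ℕ) (u v : ℝ) :
    IntervalIntegrable (fun x => walsh a x * walsh b x) volume u v := by
  rw [intervalIntegrable_iff]
  apply MeasureTheory.Measure.integrableOn_of_bounded (M := 1)
  · simp
  · exact ((measurable_walsh a).mul (measurable_walsh b)).aestronglyMeasurable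
  · filter_upwards with x
    rw [Real.norm_eq_abs, abs_mul, abs_walsh, abs_walsh]; norm_num

lemma walsh_bit (β n : ℕ) (hβ : β < 2) (x : ℝ) :
    walsh (β + 2 * n) x = walsh β x * walsh n (2 * x) := by
  have := walsh_add_mul 1 β n (by simpa using hβ) x
  simpa using this

lemma ortho (L : ℕ) : ∀ a b : ℕ, a < 2 ^ L → b < 2 ^ L →
    ∫ x in (0:ℝ)..1, walsh a x * walsh b x = if a = b then 1 else 0 := by
  induction L with
  | zero =>
    intro a b ha hb
    have ha : a = 0 := by simpa using ha
    have hb : b = 0 := by simpa using hb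
    subst ha hb
    simp [walsh_zero]
  | succ L ih =>
    intro a b ha hb
    obtain ⟨α, a', hα, rfl⟩ : ∃ α a', α < 2 ∧ a = α + 2 * a' := ⟨a % 2, a / 2, by omega, by omega⟩
    obtain ⟨β, b', hβ, rfl⟩ : ∃ β b', β < 2 ∧ b = β + 2 * b' := ⟨b % 2, b / 2, by omega, by omega⟩
    have ih' := ih a' b' (by rw [pow_succ] at ha; omega) (by rw [pow_succ] at hb; omega)
    rw [← intervalIntegral.integral_add_adjacent_intervals (b := (1/2 : ℝ))
      (intervalIntegrable_ww _ _ _ _) (intervalIntegrable_ww _ _ _ _)]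
    have per : Function.Periodic (fun x => walsh a' x * walsh b' x) 1 := by
      intro x; simp only [walsh_periodic a' x, walsh_periodic b' x]
    have h1 : ∫ x in (0:ℝ)..(1/2), walsh (α + 2 * a') x * walsh (β + 2 * b') x
        = (1/2) * if a' = b' then 1 else 0 := by
      have : ∫ x in (0:ℝ)..(1/2), walsh (α + 2 * a') x * walsh (β + 2 * b') x
         = ∫ x in (0:ℝ)..(1/2), (fun y => walsh a' y * walsh b' y) (2 * x) := by
        apply intervalIntegral.integral_congr_ae
        have : ∀ᵐ x : ℝ, x ≠ 1/2 := by simp [ae_iff]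
        filter_upwards [this] with x hx' hx
        rw [Set.uIoc_of_le (by norm_num)] at hx
        have hlt : x < 1/2 := lt_of_le_of_ne hx.2 hx'
        have hr : rad0 x = 1 := by
          unfold rad0
          rw [Int.fract_eq_self.2 ⟨hx.1.le, by linarith⟩, if_pos hlt]
        have hc : ∀ α < 2, walsh α x = 1 := by
          intro α hα
          interval_cases α
          · exact walsh_zero x
          · rw [walsh_one, hr]
        simp only [walsh_bit _ _ hα, walsh_bit _ _ hβ, hc _ hα, hc _ hβ]; ring
      rw [this, intervalIntegral.integral_comp_mul_left (fun y => walsh a' y * walsh b' y)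
        (two_ne_zero : (2:ℝ) ≠ 0)]
      norm_num [ih']
    have h2 : ∫ x in (1/2:ℝ)..1, walsh (α + 2 * a') x * walsh (β + 2 * b') x
        = (if α = β then 1 else -1) * ((1/2) * if a' = b' then 1 else 0) := by
      have : ∫ x in (1/2:ℝ)..1, walsh (α + 2 * a') x * walsh (β + 2 * b') x
         = ∫ x in (1/2:ℝ)..1, (if α = β then 1 else -1) *
            (fun y => walsh a' y * walsh b' y) (2 * x) := by
        apply intervalIntegral.integral_congr_ae
        have : ∀ᵐ x : ℝ, x ≠ 1 := by simp [ae_iff]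
        filter_upwards [this] with x hx' hx
        rw [Set.uIoc_of_le (by norm_num)] at hx
        have hlt : x < 1 := lt_of_le_of_ne hx.2 hx'
        have hr : rad0 x = -1 := by
          unfold rad0
          rw [Int.fract_eq_self.2 ⟨by linarith [hx.1], by linarith⟩, if_neg (by linarith [hx.1])]
        have hc : walsh α x * walsh β x = if α = β then 1 else -1 := by
          interval_cases α <;> interval_cases β <;> simp [walsh_one, walsh_zero, hr]
        simp only [walsh_bit _ _ hα, walsh_bit _ _ hβ, ← hc]; ring
      rw [this, intervalIntegral.integral_const_mul,
        intervalIntegral.integral_comp_mul_left (fun y => walsh a' y * walsh b' y)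
        (two_ne_zero : (2:ℝ) ≠ 0)]
      have h3 := per.intervalIntegral_add_eq 1 0
      norm_num at h3
      norm_num [h3, ih']
    rw [h1, h2]
    by_cases hab : a' = b'
    · subst hab
      by_cases hh : α = β
      · simp [hh]; norm_num
      · simp [hh]
    · have : α + 2 * a' ≠ β + 2 * b' := by omega
      simp [hab, this]

lemma ortho' (a b : ℕ) :
    ∫ x in Set.Ico (0:ℝ) 1, walsh a x * walsh b x = if a = b then 1 else 0 := by
  rw [integral_Ico_eq_integral_Ioc, ← intervalIntegral.integral_of_le (by norm_num)]
  apply ortho (a + b)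
  · exact lt_of_le_of_lt (Nat.le_add_right a b) Nat.lt_two_pow_self
  · exact lt_of_le_of_lt (Nat.le_add_left b a) Nat.lt_two_pow_self

/-- Walsh polynomial -/
noncomputable def wpoly (F : Finset ℕ) (c : ℕ → ℝ) (x : ℝ) : ℝ := ∑ k ∈ F, c k * walsh k x

lemma measurable_wpoly (F : Finset ℕ) (c : ℕ → ℝ) : Measurable (wpoly F c) := by
  unfold wpoly
  apply Finset.measurable_fun_sum
  intro i _
  exact measurable_const.mul (measurable_walsh i)

lemma abs_wpoly_le (F : Finset ℕ) (c : ℕ → ℝ) (x : ℝ) : |wpoly F c x| ≤ ∑ k ∈ F, |c k| := by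
  unfold wpoly
  refine (Finset.abs_sum_le_sum_abs _ _).trans (Finset.sum_le_sum fun k _ => ?_)
  rw [abs_mul, abs_walsh, mul_one]

lemma integrableOn_of_bdd {f : ℝ → ℝ} (hf : Measurable f) (M : ℝ) (hM : ∀ x, |f x| ≤ M)
    {e : Set ℝ} (he : e ⊆ Set.Ico 0 1) : IntegrableOn f e := by
  refine IntegrableOn.mono_set ?_ he
  apply MeasureTheory.Measure.integrableOn_of_bounded (M := M)
  · simp
  · exact hf.aestronglyMeasurable
  · filter_upwards with x
    exact hM x

lemma integral_wpoly_sq (F : Finset ℕ) (c : ℕ → ℝ) :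
    ∫ x in Set.Ico (0:ℝ) 1, (wpoly F c x) ^ 2 = ∑ k ∈ F, c k ^ 2 := by
  have hww : ∀ a b : ℕ, IntegrableOn (fun x => walsh a x * walsh b x) (Set.Ico 0 1) := by
    intro a b
    refine integrableOn_of_bdd ((measurable_walsh a).mul (measurable_walsh b)) 1 ?_ subset_rfl
    intro x; rw [Pi.mul_apply, abs_mul, abs_walsh, abs_walsh]; norm_num
  have h1 : ∀ x, (wpoly F c x) ^ 2 =
      ∑ k ∈ F, ∑ l ∈ F, (c k * c l) * (walsh k x * walsh l x) := by
    intro x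
    rw [wpoly, sq, Finset.sum_mul_sum]
    refine Finset.sum_congr rfl fun k _ => Finset.sum_congr rfl fun l _ => by ring
  simp_rw [h1]
  rw [integral_finsetSum]
  · refine Finset.sum_congr rfl fun k hk => ?_
    rw [integral_finsetSum]
    · simp_rw [integral_const_mul, ortho']
      simp [hk, sq]
    · intro l _; exact (hww k l).const_mul _
  · intro k _
    apply integrable_finsetSum
    intro l _; exact (hww k l).const_mul _

lemma integral_wpoly (F : Finset ℕ) (c : ℕ → ℝ) (hF : ∀ k ∈ F, 1 ≤ k) :
    ∫ x in Set.Ico (0:ℝ) 1, wpoly F c x = 0 := by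
  unfold wpoly
  rw [integral_finsetSum]
  · apply Finset.sum_eq_zero
    intro k hk
    rw [integral_const_mul]
    have := ortho' k 0
    simp only [walsh_zero, mul_one] at this
    rw [this, if_neg (by have := hF k hk; omega), mul_zero]
  · intro k _
    refine Integrable.const_mul ?_ _
    exact integrableOn_of_bdd (measurable_walsh k) 1 (fun x => (abs_walsh k x).le) subset_rfl

lemma small_L1 (F : Finset ℕ) (c : ℕ → ℝ) (ε : ℝ) (hε : 0 < ε)
    (h : ∑ k ∈ F, c k ^ 2 ≤ ε ^ 2 / 4) (e : Set ℝ) (he : e ⊆ Set.Ico 0 1) :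
    ∫ x in e, |wpoly F c x| < ε := by
  have hm := measurable_wpoly F c
  have hi1 : IntegrableOn (fun x => |wpoly F c x|) (Set.Ico 0 1) :=
    integrableOn_of_bdd hm.abs (∑ k ∈ F, |c k|)
      (fun x => by rw [abs_abs]; exact abs_wpoly_le F c x) subset_rfl
  have hi2 : IntegrableOn (fun x => (wpoly F c x) ^ 2) (Set.Ico 0 1) :=
    integrableOn_of_bdd (hm.pow_const 2) ((∑ k ∈ F, |c k|) ^ 2)
      (fun x => by
        rw [abs_pow]
        exact pow_le_pow_left₀ (abs_nonneg _) (abs_wpoly_le F c x) 2) subset_rfl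
  calc ∫ x in e, |wpoly F c x| ≤ ∫ x in Set.Ico (0:ℝ) 1, |wpoly F c x| := by
        apply setIntegral_mono_set hi1
        · filter_upwards with x; exact abs_nonneg _
        · exact he.eventuallyLE
    _ ≤ ∫ x in Set.Ico (0:ℝ) 1, (ε / 4 + ε⁻¹ * (wpoly F c x) ^ 2) := by
        apply integral_mono hi1
        · exact (integrable_const _).add (hi2.const_mul _)
        · intro x
          have h1 : ε * |wpoly F c x| ≤ ε ^ 2 / 4 + (wpoly F c x) ^ 2 := by
            nlinarith [sq_nonneg (ε / 2 - |wpoly F c x|), sq_abs (wpoly F c x)]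
          have h2 : |wpoly F c x| = ε⁻¹ * (ε * |wpoly F c x|) := by field_simp
          show |wpoly F c x| ≤ _
          rw [h2]
          calc ε⁻¹ * (ε * |wpoly F c x|) ≤ ε⁻¹ * (ε ^ 2 / 4 + (wpoly F c x) ^ 2) := by gcongr
            _ = _ := by field_simp
    _ = ε / 4 + ε⁻¹ * ∑ k ∈ F, c k ^ 2 := by
        rw [integral_add (integrable_const _) (hi2.const_mul _), integral_const_mul,
          integral_wpoly_sq]
        simp
    _ ≤ ε / 4 + ε⁻¹ * (ε ^ 2 / 4) := by gcongr
    _ = ε / 2 := by field_simp; ring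
    _ < ε := by linarith

lemma dirichlet_two (m : ℕ) (x t : ℝ) :
    ∑ k ∈ Finset.range (2 ^ (m + 1)), walsh k x * walsh k t =
      (∑ k ∈ Finset.range (2 ^ m), walsh k x * walsh k t) *
        (1 + rad0 (2 ^ m * x) * rad0 (2 ^ m * t)) := by
  rw [pow_succ, mul_two, Finset.sum_range_add, mul_add, mul_one, Finset.sum_mul]
  congr 1
  apply Finset.sum_congr rfl
  intro k hk
  have h := Finset.mem_range.1 hk
  have h1 := walsh_add_mul m k 1 h x
  have h2 := walsh_add_mul m k 1 h t
  rw [mul_one, walsh_one] at h1 h2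
  rw [add_comm (2 ^ m) k, h1, h2]; ring

lemma dirichlet_cases (ν : ℕ) (y : ℝ) :
    ∑ k ∈ Finset.range (2 ^ ν), walsh k y = 0 ∨
    ∑ k ∈ Finset.range (2 ^ ν), walsh k y = 2 ^ ν := by
  have h0 : ∀ k, walsh k 0 = 1 := by
    intro k; unfold walsh; apply Finset.prod_eq_one; intro i _; simp [rad, rad0]
  have : ∀ ν, ∑ k ∈ Finset.range (2 ^ ν), walsh k y =
      ∑ k ∈ Finset.range (2 ^ ν), walsh k y * walsh k 0 := by
    intro ν; simp [h0]
  rw [this]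
  induction ν with
  | zero => right; simp [walsh_zero]
  | succ ν ih =>
    rw [dirichlet_two]
    have hr : rad0 (2 ^ ν * 0) = 1 := by simp [rad0]
    rw [hr]
    rcases ih with h | h
    · left; rw [h, zero_mul]
    · rcases rad0_cases (2 ^ ν * y) with h' | h'
      · right; rw [h, h', pow_succ]; norm_num
      · left; rw [h']; norm_num

lemma floor_two_mul (y : ℝ) : ⌊2 * y⌋ = 2 * ⌊y⌋ + if rad0 y = 1 then 0 else 1 := by
  have h1 := Int.fract_add_floor y
  have h2 := Int.fract_nonneg y
  have h3 := Int.fract_lt_one y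
  rw [Int.floor_eq_iff]
  unfold rad0
  by_cases h : Int.fract y < 1/2
  · simp only [h, if_true]; push_cast; constructor <;> linarith
  · simp only [h, if_false]; norm_num; norm_num at h; constructor <;> linarith

lemma dirichlet_kernel (m : ℕ) (x t : ℝ) (hx : x ∈ Set.Ico (0:ℝ) 1) (ht : t ∈ Set.Ico (0:ℝ) 1) :
    ∑ k ∈ Finset.range (2 ^ m), walsh k x * walsh k t =
      if ⌊2 ^ m * x⌋ = ⌊2 ^ m * t⌋ then 2 ^ m else 0 := by
  induction m with
  | zero =>
    have h1 : ⌊x⌋ = 0 := Int.floor_eq_zero_iff.2 hx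
    have h2 : ⌊t⌋ = 0 := Int.floor_eq_zero_iff.2 ht
    simp [walsh_zero, h1, h2]
  | succ m ih =>
    rw [dirichlet_two, ih]
    have e : ∀ z : ℝ, (2:ℝ) ^ (m + 1) * z = 2 * (2 ^ m * z) := by intro z; ring
    rw [e x, e t, floor_two_mul, floor_two_mul (2 ^ m * t)]
    generalize ⌊2 ^ m * x⌋ = u
    generalize ⌊2 ^ m * t⌋ = v
    rcases rad0_cases (2 ^ m * x) with h | h <;> rcases rad0_cases (2 ^ m * t) with h' | h' <;>
      rw [h, h'] <;> norm_num <;> (try split_ifs) <;> first | omega | ring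

lemma sum_range_mul' (a b : ℕ) (f : ℕ → ℝ) :
    ∑ k ∈ Finset.range (a * b), f k =
      ∑ l ∈ Finset.range b, ∑ r ∈ Finset.range a, f (r + a * l) := by
  induction b with
  | zero => simp
  | succ b ih =>
    rw [Nat.mul_succ, Finset.sum_range_add, Finset.sum_range_succ, ih]
    congr 1
    exact Finset.sum_congr rfl fun r _ => by rw [add_comm]

/-- frequencies of a block -/
def bcond (m ν s k : ℕ) : Prop := 2 ^ s ≤ k ∧ k < 2 ^ (s + ν) ∧ k % 2 ^ s < 2 ^ m

/-- coefficients of a block -/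
noncomputable def cb (m ν s : ℕ) (g t : ℝ) (k : ℕ) : ℝ :=
  if bcond m ν s k then -g / 2 ^ m * walsh (k % 2 ^ s) t else 0

lemma abs_cb_le (m ν s : ℕ) (g t C : ℝ) (hg : |g| ≤ C) (k : ℕ) :
    |cb m ν s g t k| ≤ if bcond m ν s k then C / 2 ^ m else 0 := by
  unfold cb
  split_ifs
  · rw [abs_mul, abs_walsh, mul_one, abs_div, abs_neg, abs_of_pos (by positivity : (0:ℝ) < 2 ^ m)]
    gcongr
  · simp

lemma card_cond (m ν s : ℕ) (F : Finset ℕ) :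
    (F.filter (bcond m ν s)).card ≤ 2 ^ m * 2 ^ ν := by
  have : (F.filter (bcond m ν s)).card ≤
      (Finset.range (2 ^ m) ×ˢ Finset.range (2 ^ ν)).card := by
    apply Finset.card_le_card_of_injOn (fun k => (k % 2 ^ s, k / 2 ^ s))
    · intro k hk
      have hk' : bcond m ν s k := by simpa using (Finset.mem_filter.1 hk).2
      obtain ⟨_, h2, h3⟩ := hk'
      simp only [Finset.coe_product, Set.mem_prod, Finset.coe_range, Set.mem_Iio]
      refine ⟨h3, ?_⟩
      rw [Nat.div_lt_iff_lt_mul (by positivity), mul_comm, ← pow_add]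
      exact h2
    · intro k _ k' _ h
      simp only [Prod.mk.injEq] at h
      rw [← Nat.mod_add_div k (2 ^ s), ← Nat.mod_add_div k' (2 ^ s), h.1, h.2]
  simpa using this

lemma sum_cond_le (m ν s : ℕ) (F : Finset ℕ) (θ : ℝ) (hθ : 0 ≤ θ) :
    ∑ k ∈ F, (if bcond m ν s k then θ else 0) ≤ 2 ^ m * 2 ^ ν * θ := by
  rw [← Finset.sum_filter, Finset.sum_const, nsmul_eq_mul]
  have := card_cond m ν s F
  have h : ((F.filter (bcond m ν s)).card : ℝ) ≤ 2 ^ m * 2 ^ ν := by exact_mod_cast this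
  gcongr

lemma wpoly_cb (m ν s : ℕ) (hms : m ≤ s) (g t x : ℝ) (F : Finset ℕ)
    (hF : Finset.Ico (2 ^ s) (2 ^ (s + ν)) ⊆ F) (hx : x ∈ Set.Ico (0:ℝ) 1)
    (ht : t ∈ Set.Ico (0:ℝ) 1) :
    wpoly F (cb m ν s g t) x = (if ⌊2 ^ m * x⌋ = ⌊2 ^ m * t⌋ then g else 0) *
      (1 - ∑ l ∈ Finset.range (2 ^ ν), walsh l (2 ^ s * x)) := by
  have hz : ∀ k, k ∉ Finset.Ico (2 ^ s) (2 ^ (s + ν)) → cb m ν s g t k * walsh k x = 0 := by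
    intro k hk
    unfold cb
    rw [if_neg, zero_mul]
    intro h
    exact hk (Finset.mem_Ico.2 ⟨h.1, h.2.1⟩)
  unfold wpoly
  rw [← Finset.sum_subset hF (fun k _ hk => hz k hk)]
  have hsub : Finset.Ico (2 ^ s) (2 ^ (s + ν)) ⊆ Finset.range (2 ^ (s + ν)) := by
    intro k hk; exact Finset.mem_range.2 (Finset.mem_Ico.1 hk).2
  rw [Finset.sum_subset hsub (fun k _ hk => hz k hk), pow_add, sum_range_mul']
  set A : ℝ := if ⌊2 ^ m * x⌋ = ⌊2 ^ m * t⌋ then g else 0 with hA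
  have hAsum : ∑ r ∈ Finset.range (2 ^ m), (-g / 2 ^ m * walsh r t) * walsh r x = -A := by
    have h1 := dirichlet_kernel m x t hx ht
    have : ∑ r ∈ Finset.range (2 ^ m), (-g / 2 ^ m * walsh r t) * walsh r x =
        -g / 2 ^ m * ∑ r ∈ Finset.range (2 ^ m), walsh r x * walsh r t := by
      rw [Finset.mul_sum]; exact Finset.sum_congr rfl fun r _ => by ring
    rw [this, h1, hA]
    split_ifs
    · field_simp
    · simp
  have inner : ∀ l ∈ Finset.range (2 ^ ν), ∑ r ∈ Finset.range (2 ^ s),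
      cb m ν s g t (r + 2 ^ s * l) * walsh (r + 2 ^ s * l) x =
      -A * walsh l (2 ^ s * x) + if l = 0 then A else 0 := by
    intro l hl
    rw [Finset.mem_range] at hl
    by_cases h0 : l = 0
    · subst h0
      rw [walsh_zero, if_pos rfl]
      rw [Finset.sum_eq_zero]
      · ring
      · intro r hr
        rw [Finset.mem_range] at hr
        apply hz
        rw [Finset.mem_Ico]; omega
    · rw [if_neg h0, ← hAsum, add_zero, Finset.sum_mul]
      have hsub' : Finset.range (2 ^ m) ⊆ Finset.range (2 ^ s) := by
        intro r; simp only [Finset.mem_range]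
        intro h; exact lt_of_lt_of_le h (Nat.pow_le_pow_right (by norm_num) hms)
      symm
      have hmod : ∀ r ∈ Finset.range (2 ^ s), (r + 2 ^ s * l) % 2 ^ s = r := by
        intro r hr
        rw [Nat.add_mul_mod_self_left, Nat.mod_eq_of_lt (Finset.mem_range.1 hr)]
      have hlow : ∀ r, 2 ^ s ≤ r + 2 ^ s * l := by
        intro r
        have : 2 ^ s * 1 ≤ 2 ^ s * l := Nat.mul_le_mul_left _ (by omega)
        omega
      have hhigh : ∀ r ∈ Finset.range (2 ^ s), r + 2 ^ s * l < 2 ^ (s + ν) := by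
        intro r hr
        have hr := Finset.mem_range.1 hr
        rw [pow_add]
        have : 2 ^ s * (l + 1) ≤ 2 ^ s * 2 ^ ν := Nat.mul_le_mul_left _ hl
        rw [mul_add] at this
        omega
      rw [← Finset.sum_subset hsub' (f := fun r => cb m ν s g t (r + 2 ^ s * l) * walsh (r + 2 ^ s * l) x)]
      · apply Finset.sum_congr rfl
        intro r hr
        have hr' := hsub' hr
        unfold cb bcond
        rw [hmod r hr', if_pos ⟨hlow r, hhigh r hr', Finset.mem_range.1 hr⟩,
          walsh_add_mul s r l (Finset.mem_range.1 hr')]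
        ring
      · intro r hr hr'
        unfold cb bcond
        rw [hmod r hr, if_neg, zero_mul]
        intro h; exact hr' (Finset.mem_range.2 h.2.2)
  rw [Finset.sum_congr rfl inner, Finset.sum_add_distrib, ← Finset.mul_sum]
  have : ∑ l ∈ Finset.range (2 ^ ν), (if l = 0 then A else 0) = A := by
    rw [Finset.sum_ite_eq' ]
    simp
  rw [this]; ring

/-- block index of a frequency -/
def bi (s0 ν k : ℕ) : ℕ := (Nat.log 2 k - s0) / ν

lemma bi_of_cond {m ν s0 j k : ℕ} (hν : 0 < ν) (h : bcond m ν (s0 + j * ν) k) : bi s0 ν k = j := by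
  obtain ⟨h1, h2, _⟩ := h
  have hk : k ≠ 0 := by
    intro h; subst h; have : 0 < 2 ^ (s0 + j * ν) := by positivity
    omega
  have h3 : s0 + j * ν ≤ Nat.log 2 k := (Nat.le_log_iff_pow_le (by norm_num) hk).2 h1
  have h4 : Nat.log 2 k < s0 + j * ν + ν := (Nat.log_lt_iff_lt_pow (by norm_num) hk).2 h2
  unfold bi
  rw [Nat.div_eq_iff hν]; omega

lemma bi_spec (s0 ν n : ℕ) (hν : 0 < ν) : n < 2 ^ (s0 + bi s0 ν n * ν + ν) ∧
    ∀ j < bi s0 ν n, 2 ^ (s0 + j * ν + ν) ≤ n := by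
  unfold bi
  set L := Nat.log 2 n with hL
  have h1 : (L - s0) / ν * ν ≤ L - s0 := Nat.div_mul_le_self _ _
  have h2 : L - s0 < (L - s0) / ν * ν + ν := Nat.lt_div_mul_add hν
  constructor
  · have : n < 2 ^ (L + 1) := Nat.lt_pow_succ_log_self (by norm_num) n
    refine lt_of_lt_of_le this (Nat.pow_le_pow_right (by norm_num) ?_)
    omega
  · intro j hj
    have h3 : (j + 1) * ν ≤ (L - s0) / ν * ν := Nat.mul_le_mul_right _ hj
    have h4 : (j + 1) * ν = j * ν + ν := by ring
    have h5 : 0 < L := by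
      by_contra h
      have : L - s0 = 0 := by omega
      rw [this] at hj; simp at hj
    have hn : n ≠ 0 := by rintro rfl; simp at hL; omega
    refine (Nat.le_log_iff_pow_le (by norm_num) hn).1 ?_
    omega

/-- total coefficients -/
noncomputable def ctot (m ν s0 : ℕ) (g : ℕ → ℝ) (k : ℕ) : ℝ :=
  ∑ j ∈ Finset.range (2 ^ m), cb m ν (s0 + j * ν) (g j) ((j:ℝ) / 2 ^ m) k

lemma wpoly_ctot (m ν s0 : ℕ) (g : ℕ → ℝ) (F : Finset ℕ) (x : ℝ) :
    wpoly F (ctot m ν s0 g) x =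
      ∑ j ∈ Finset.range (2 ^ m), wpoly F (cb m ν (s0 + j * ν) (g j) ((j:ℝ) / 2 ^ m)) x := by
  unfold wpoly ctot
  rw [Finset.sum_comm]
  exact Finset.sum_congr rfl fun k _ => by rw [Finset.sum_mul]

lemma dyadic_floor (m : ℕ) (x : ℝ) (hx : x ∈ Set.Ico (0:ℝ) 1) :
    ∃ i < 2 ^ m, ⌊2 ^ m * x⌋ = ((i : ℕ) : ℤ) := by
  have h0 : 0 ≤ ⌊2 ^ m * x⌋ := Int.floor_nonneg.2 (mul_nonneg (by positivity) hx.1)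
  have h1 : ⌊2 ^ m * x⌋ < ((2 ^ m : ℕ) : ℤ) := by
    rw [Int.floor_lt]
    push_cast
    have : (0:ℝ) < 2 ^ m := by positivity
    nlinarith [hx.2]
  refine ⟨⌊2 ^ m * x⌋.toNat, ?_, ?_⟩ <;> omega

lemma floor_tj (m j : ℕ) : ⌊(2:ℝ) ^ m * ((j:ℝ) / 2 ^ m)⌋ = (j:ℤ) := by
  rw [mul_div_cancel₀ _ (by positivity)]; simp

lemma tj_mem (m j : ℕ) (hj : j < 2 ^ m) : (j:ℝ) / 2 ^ m ∈ Set.Ico (0:ℝ) 1 := by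
  constructor
  · positivity
  · rw [div_lt_one (by positivity)]; exact_mod_cast hj

lemma block_full (m ν s : ℕ) (hs : m ≤ s) (g : ℝ) (j i : ℕ) (hj : j < 2 ^ m) (F : Finset ℕ)
    (hF : Finset.Ico (2 ^ s) (2 ^ (s + ν)) ⊆ F) (x : ℝ) (hx : x ∈ Set.Ico (0:ℝ) 1)
    (hi : ⌊2 ^ m * x⌋ = (i:ℤ)) :
    wpoly F (cb m ν s g ((j:ℝ) / 2 ^ m)) x =
      if i = j then g * (1 - ∑ l ∈ Finset.range (2 ^ ν), walsh l (2 ^ s * x)) else 0 := by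
  rw [wpoly_cb m ν s hs g _ x F hF hx (tj_mem m j hj), floor_tj, hi]
  simp only [Nat.cast_inj]
  split_ifs <;> simp

lemma ctot_full (m ν s0 : ℕ) (hs : m ≤ s0) (g : ℕ → ℝ) (i : ℕ) (hi' : i < 2 ^ m) (F : Finset ℕ)
    (hF : ∀ j < 2 ^ m, Finset.Ico (2 ^ (s0 + j * ν)) (2 ^ (s0 + j * ν + ν)) ⊆ F)
    (x : ℝ) (hx : x ∈ Set.Ico (0:ℝ) 1) (hi : ⌊2 ^ m * x⌋ = (i:ℤ)) :
    wpoly F (ctot m ν s0 g) x =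
      g i * (1 - ∑ l ∈ Finset.range (2 ^ ν), walsh l (2 ^ (s0 + i * ν) * x)) := by
  rw [wpoly_ctot, Finset.sum_eq_single i]
  · rw [block_full m ν _ (by omega) (g i) i i hi' F (hF i hi') x hx hi, if_pos rfl]
  · intro j hj hji
    have hj := Finset.mem_range.1 hj
    rw [block_full m ν _ (by omega) (g j) j i hj F (hF j hj) x hx hi, if_neg (Ne.symm hji)]
  · intro h; exact absurd (Finset.mem_range.2 hi') h

lemma bad_measure (m ν s0 : ℕ) (hs : m ≤ s0) (F : Finset ℕ) (hF1 : ∀ k ∈ F, 1 ≤ k)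
    (hF : ∀ j < 2 ^ m, Finset.Ico (2 ^ (s0 + j * ν)) (2 ^ (s0 + j * ν + ν)) ⊆ F) :
    volume {x | x ∈ Set.Ico (0:ℝ) 1 ∧ wpoly F (ctot m ν s0 (fun _ => 1)) x ≠ 1} ≤
      ENNReal.ofReal (1 / 2 ^ ν) := by
  set Q := wpoly F (ctot m ν s0 (fun _ => 1)) with hQ
  set B := {x | x ∈ Set.Ico (0:ℝ) 1 ∧ Q x ≠ 1} with hB
  have hQm : Measurable Q := measurable_wpoly _ _
  have hBsub : B ⊆ Set.Ico 0 1 := fun x hx => hx.1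
  have hBm : MeasurableSet B :=
    measurableSet_Ico.inter (hQm (measurableSet_singleton (1:ℝ)).compl)
  have hval : ∀ x ∈ Set.Ico (0:ℝ) 1, 1 - Q x = 0 ∨ 1 - Q x = 2 ^ ν := by
    intro x hx
    obtain ⟨i, hi', hi⟩ := dyadic_floor m x hx
    rw [hQ, ctot_full m ν s0 hs _ i hi' F hF x hx hi]
    rcases dirichlet_cases ν (2 ^ (s0 + i * ν) * x) with h | h <;> rw [h] <;> simp
  have hQi : IntegrableOn Q (Set.Ico 0 1) := integrableOn_of_bdd hQm _ (abs_wpoly_le _ _) subset_rfl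
  have hi : IntegrableOn (fun x => 1 - Q x) (Set.Ico 0 1) :=
    Integrable.sub (integrable_const (1:ℝ)) hQi
  have hfull : ∫ x in Set.Ico (0:ℝ) 1, (1 - Q x) = 1 := by
    rw [integral_sub (integrable_const _) hQi, hQ, integral_wpoly F _ hF1]
    simp
  have hBint : ∫ x in B, (1 - Q x) = volume.real B * 2 ^ ν := by
    have : ∫ x in B, (1 - Q x) = ∫ x in B, (2:ℝ) ^ ν := by
      apply setIntegral_congr_fun hBm
      intro x hx
      rcases hval x hx.1 with h | h
      · exact absurd (by linarith) hx.2
      · exact h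
    rw [this, setIntegral_const, smul_eq_mul]
  have hle : volume.real B * 2 ^ ν ≤ 1 := by
    rw [← hBint]; refine le_of_le_of_eq ?_ hfull
    apply setIntegral_mono_set hi
    · rw [Filter.EventuallyLE, ae_restrict_iff' measurableSet_Ico]
      filter_upwards with x hx
      rcases hval x hx with h | h <;> simp only [Pi.zero_apply, h] <;> positivity
    · exact hBsub.eventuallyLE
  have hfin : volume B ≠ ⊤ := by
    refine ne_top_of_le_ne_top ?_ (measure_mono hBsub)
    simp
  rw [← ENNReal.ofReal_toReal hfin]
  apply ENNReal.ofReal_le_ofReal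
  rw [le_div_iff₀ (by positivity)]
  exact hle

lemma core (ε : ℝ) (hε0 : 0 < ε) (hε1 : ε < 1) (N0 : ℕ) (hN0 : 2 < N0) (f : ℝ → ℝ)
    (hf : Measurable f) (C : ℝ) (hC : 0 < C) (hfC : ∀ x, |f x| ≤ C) (m ν : ℕ)
    (g : ℕ → ℝ) (hg : ∀ j, |g j| ≤ C)
    (hfg : ∀ x ∈ Set.Ico (0:ℝ) 1, (∀ n : ℤ, 2 ^ m * x ≠ n) → ∀ j : ℕ,
      ⌊2 ^ m * x⌋ = (j:ℤ) → f x = g j)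
    (h1 : (2:ℝ) ^ m * (2 ^ m * 2 ^ ν * (C / 2 ^ m) ^ (2 + ε)) < ε)
    (h2 : (2:ℝ) ^ m * 2 ^ ν * (C / 2 ^ m) ^ 2 ≤ ε ^ 2 / 4)
    (h3 : (1:ℝ) / 2 ^ ν < ε) :
    ∃ (E : Set ℝ) (N : ℕ) (c : ℕ → ℝ),
      MeasurableSet E ∧ E ⊆ Set.Icc 0 1 ∧
      volume E > ENNReal.ofReal (1 - ε) ∧ N0 ≤ N ∧
      (∀ x ∈ E, wpoly (Finset.Icc N0 N) c x = f x) ∧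
      (∑ k ∈ Finset.Icc N0 N, |c k| ^ (2 + ε) < ε) ∧
      (∀ e ⊆ E, MeasurableSet e → ∀ n ∈ Finset.Ico N0 N,
        (∫ x in e, |wpoly (Finset.Icc N0 n) c x|) < ε + ∫ x in e, |f x|) := by
  have hν : 0 < ν := by
    rcases Nat.eq_zero_or_pos ν with h | h
    · subst h; norm_num at h3; linarith
    · exact h
  set s0 := m + N0 with hs0
  have hs : m ≤ s0 := by omega
  have hN0s : N0 ≤ 2 ^ s0 := by
    have : N0 < 2 ^ N0 := Nat.lt_two_pow_self
    exact this.le.trans (Nat.pow_le_pow_right (by norm_num) (by omega))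
  set N := 2 ^ (s0 + 2 ^ m * ν) with hN
  have hblock : ∀ n j : ℕ, 2 ^ (s0 + j * ν + ν) ≤ n →
      Finset.Ico (2 ^ (s0 + j * ν)) (2 ^ (s0 + j * ν + ν)) ⊆ Finset.Icc N0 n := by
    intro n j hn k hk
    rw [Finset.mem_Ico] at hk
    rw [Finset.mem_Icc]
    have : 2 ^ s0 ≤ 2 ^ (s0 + j * ν) := Nat.pow_le_pow_right (by norm_num) (by omega)
    omega
  have hF : ∀ j < 2 ^ m, Finset.Ico (2 ^ (s0 + j * ν)) (2 ^ (s0 + j * ν + ν)) ⊆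
      Finset.Icc N0 N := by
    intro j hj
    apply hblock
    apply Nat.pow_le_pow_right (by norm_num)
    have : (j + 1) * ν ≤ 2 ^ m * ν := Nat.mul_le_mul_right _ hj
    rw [add_mul] at this
    omega
  have hF1 : ∀ k ∈ Finset.Icc N0 N, 1 ≤ k := by
    intro k hk; have := (Finset.mem_Icc.1 hk).1; omega
  set Q := wpoly (Finset.Icc N0 N) (ctot m ν s0 (fun _ => 1)) with hQ
  have hQm : Measurable Q := measurable_wpoly _ _
  set Z : Set ℝ := {x | ∃ n : ℤ, 2 ^ m * x = n} with hZ
  have hZc : Z.Countable := by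
    have : Z ⊆ Set.range (fun n : ℤ => (n:ℝ) / 2 ^ m) := by
      rintro x ⟨n, hn⟩
      refine ⟨n, ?_⟩
      simp only [← hn]; field_simp
    exact (Set.countable_range _).mono this
  set E : Set ℝ := {x | x ∈ Set.Ico (0:ℝ) 1 ∧ Q x = 1} \ Z with hE
  have hEIco : E ⊆ Set.Ico 0 1 := fun x hx => hx.1.1
  -- block values on E
  have hval : ∀ x ∈ E, ∃ i < 2 ^ m, f x = g i ∧ ∀ j < 2 ^ m, ∀ F : Finset ℕ,
      Finset.Ico (2 ^ (s0 + j * ν)) (2 ^ (s0 + j * ν + ν)) ⊆ F →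
      wpoly F (cb m ν (s0 + j * ν) (g j) ((j:ℝ) / 2 ^ m)) x = if i = j then g j else 0 := by
    intro x hx
    have hxI := hEIco hx
    obtain ⟨i, hi', hi⟩ := dyadic_floor m x hxI
    have hxZ : ∀ n : ℤ, 2 ^ m * x ≠ n := by
      intro n hn; exact hx.2 ⟨n, hn⟩
    refine ⟨i, hi', hfg x hxI hxZ i hi, ?_⟩
    intro j hj F hFj
    have hq : Q x = 1 := hx.1.2
    rw [hQ, ctot_full m ν s0 hs _ i hi' _ hF x hxI hi] at hq
    rw [block_full m ν _ (by omega) (g j) j i hj F hFj x hxI hi]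
    by_cases hij : i = j
    · subst hij
      rw [if_pos rfl, if_pos rfl]
      rw [one_mul] at hq
      rw [hq, mul_one]
    · rw [if_neg hij, if_neg hij]
  refine ⟨E, N, ctot m ν s0 g, ?_, ?_, ?_, ?_, ?_, ?_, ?_⟩
  · exact (measurableSet_Ico.inter (hQm (measurableSet_singleton (1:ℝ)))).diff hZc.measurableSet
  · exact hEIco.trans Set.Ico_subset_Icc_self
  · have hcov : Set.Ico (0:ℝ) 1 ⊆ E ∪ ({x | x ∈ Set.Ico (0:ℝ) 1 ∧ Q x ≠ 1} ∪ Z) := by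
      intro x hx
      by_cases hz : x ∈ Z
      · right; right; exact hz
      · by_cases hq : Q x = 1
        · left; exact ⟨⟨hx, hq⟩, hz⟩
        · right; left; exact ⟨hx, hq⟩
    have hb := bad_measure m ν s0 hs _ hF1 hF
    rw [← hQ] at hb
    have h4 : (1:ℝ≥0∞) ≤ volume E + ENNReal.ofReal (1 / 2 ^ ν) := by
      calc (1:ℝ≥0∞) = volume (Set.Ico (0:ℝ) 1) := by simp
        _ ≤ volume E + (volume {x | x ∈ Set.Ico (0:ℝ) 1 ∧ Q x ≠ 1} + volume Z) :=
            (measure_mono hcov).trans ((measure_union_le _ _).trans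
              (by gcongr; exact measure_union_le _ _))
        _ ≤ _ := by rw [hZc.measure_zero, add_zero]; gcongr
    by_contra hcon
    rw [gt_iff_lt, not_lt] at hcon
    have h5 : (1:ℝ≥0∞) ≤ ENNReal.ofReal (1 - ε + 1 / 2 ^ ν) := by
      rw [ENNReal.ofReal_add (by linarith) (by positivity)]
      exact h4.trans (by gcongr)
    rw [ENNReal.one_le_ofReal] at h5
    linarith
  · exact hN0s.trans (Nat.pow_le_pow_right (by norm_num) (by omega))
  · intro x hx
    obtain ⟨i, hi', hfx, hb⟩ := hval x hx
    rw [wpoly_ctot, Finset.sum_congr rfl (fun j hj => hb j (Finset.mem_range.1 hj) _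
      (hF j (Finset.mem_range.1 hj))), hfx]
    rw [Finset.sum_ite_eq, if_pos (Finset.mem_range.2 hi')]
  · have hp : (0:ℝ) ≤ (C / 2 ^ m) ^ (2 + ε) := by positivity
    have hk : ∀ k, |ctot m ν s0 g k| ^ (2 + ε) ≤ ∑ j ∈ Finset.range (2 ^ m),
        if bcond m ν (s0 + j * ν) k then (C / 2 ^ m) ^ (2 + ε) else 0 := by
      intro k
      have hnn : ∀ j ∈ Finset.range (2 ^ m), (0:ℝ) ≤
          if bcond m ν (s0 + j * ν) k then (C / 2 ^ m) ^ (2 + ε) else 0 := by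
        intro j _; split_ifs <;> positivity
      by_cases hc : ∃ j < 2 ^ m, bcond m ν (s0 + j * ν) k
      · obtain ⟨j, hj, hjk⟩ := hc
        have hbi := bi_of_cond hν hjk
        have : ctot m ν s0 g k = cb m ν (s0 + j * ν) (g j) ((j:ℝ) / 2 ^ m) k := by
          unfold ctot
          apply Finset.sum_eq_single_of_mem j (Finset.mem_range.2 hj)
          intro j' _ hne
          unfold cb
          rw [if_neg]
          intro h
          exact hne ((bi_of_cond hν h).symm.trans hbi)
        refine le_trans ?_ (Finset.single_le_sum hnn (Finset.mem_range.2 hj))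
        rw [this, if_pos hjk]
        have hcb := abs_cb_le m ν (s0 + j * ν) (g j) ((j:ℝ) / 2 ^ m) C (hg j) k
        rw [if_pos hjk] at hcb
        exact Real.rpow_le_rpow (abs_nonneg _) hcb (by linarith)
      · have : ctot m ν s0 g k = 0 := by
          unfold ctot
          apply Finset.sum_eq_zero
          intro j hj
          unfold cb
          rw [if_neg]
          intro h; exact hc ⟨j, Finset.mem_range.1 hj, h⟩
        rw [this, abs_zero, Real.zero_rpow (by linarith)]
        exact Finset.sum_nonneg hnn
    calc _ ≤ ∑ k ∈ Finset.Icc N0 N, ∑ j ∈ Finset.range (2 ^ m),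
        (if bcond m ν (s0 + j * ν) k then (C / 2 ^ m) ^ (2 + ε) else 0) :=
          Finset.sum_le_sum fun k _ => hk k
      _ = ∑ j ∈ Finset.range (2 ^ m), ∑ k ∈ Finset.Icc N0 N,
        (if bcond m ν (s0 + j * ν) k then (C / 2 ^ m) ^ (2 + ε) else 0) := Finset.sum_comm
      _ ≤ ∑ j ∈ Finset.range (2 ^ m), 2 ^ m * 2 ^ ν * (C / 2 ^ m) ^ (2 + ε) :=
          Finset.sum_le_sum fun j _ => sum_cond_le _ _ _ _ _ hp
      _ = 2 ^ m * (2 ^ m * 2 ^ ν * (C / 2 ^ m) ^ (2 + ε)) := by simp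
      _ < ε := h1
  · intro e heE hem n _
    set F := Finset.Icc N0 n with hFn
    set J := bi s0 ν n with hJ
    obtain ⟨hJ1, hJ2⟩ := bi_spec s0 ν n hν
    rw [← hJ] at hJ1 hJ2
    set G := cb m ν (s0 + J * ν) (g J) ((J:ℝ) / 2 ^ m) with hG
    have heI : e ⊆ Set.Ico 0 1 := heE.trans hEIco
    have hGsum : ∑ k ∈ F, G k ^ 2 ≤ ε ^ 2 / 4 := by
      refine le_trans ?_ h2
      refine le_trans (Finset.sum_le_sum fun k _ => ?_)
        (sum_cond_le m ν (s0 + J * ν) F ((C / 2 ^ m) ^ 2) (by positivity))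
      have hcb := abs_cb_le m ν (s0 + J * ν) (g J) ((J:ℝ) / 2 ^ m) C (hg J) k
      rw [← hG] at hcb
      rw [← sq_abs]
      split_ifs at hcb ⊢ with hc
      · exact pow_le_pow_left₀ (abs_nonneg _) hcb 2
      · have : |G k| = 0 := le_antisymm hcb (abs_nonneg _)
        rw [this]; norm_num
    have hsmall := small_L1 F G ε hε0 hGsum e heI
    have hpt : ∀ x ∈ e, |wpoly F (ctot m ν s0 g) x| ≤ |f x| + |wpoly F G x| := by
      intro x hx
      obtain ⟨i, hi', hfx, hb⟩ := hval x (heE hx)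
      have hz : ∀ j, J < j → wpoly F (cb m ν (s0 + j * ν) (g j) ((j:ℝ) / 2 ^ m)) x = 0 := by
        intro j hj
        unfold wpoly
        apply Finset.sum_eq_zero
        intro k hk
        have hkn := (Finset.mem_Icc.1 hk).2
        unfold cb
        rw [if_neg, zero_mul]
        intro h
        have h6 := h.1
        have h7 : (J + 1) * ν ≤ j * ν := Nat.mul_le_mul_right _ hj
        rw [add_mul] at h7
        have h8 : 2 ^ (s0 + J * ν + ν) ≤ 2 ^ (s0 + j * ν) :=
          Nat.pow_le_pow_right (by norm_num) (by omega)
        omega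
      have hterm : ∀ j ∈ Finset.range (2 ^ m),
          wpoly F (cb m ν (s0 + j * ν) (g j) ((j:ℝ) / 2 ^ m)) x =
          (if i = j then (if j < J then g j else 0) else 0) +
            if J = j then wpoly F G x else 0 := by
        intro j hj
        rcases lt_trichotomy j J with h | h | h
        · rw [hb j (Finset.mem_range.1 hj) F (hblock n j (hJ2 j h)), if_pos h, if_neg h.ne']
          simp
        · subst h
          simp [hG]
        · rw [hz j h, if_neg h.ne, if_neg h.not_gt]; simp
      rw [wpoly_ctot, Finset.sum_congr rfl hterm, Finset.sum_add_distrib, Finset.sum_ite_eq,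
        Finset.sum_ite_eq, if_pos (Finset.mem_range.2 hi')]
      refine (abs_add_le _ _).trans (add_le_add ?_ ?_)
      · rw [hfx]; split_ifs <;> simp
      · split_ifs <;> simp
    have hif : IntegrableOn (fun x => |f x|) e :=
      integrableOn_of_bdd hf.abs C (fun x => by rw [abs_abs]; exact hfC x) heI
    have hiG : IntegrableOn (fun x => |wpoly F G x|) e :=
      integrableOn_of_bdd (measurable_wpoly F G).abs _
        (fun x => by rw [abs_abs]; exact abs_wpoly_le F G x) heI
    have hiP : IntegrableOn (fun x => |wpoly F (ctot m ν s0 g) x|) e :=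
      integrableOn_of_bdd (measurable_wpoly F _).abs _
        (fun x => by rw [abs_abs]; exact abs_wpoly_le F _ x) heI
    calc ∫ x in e, |wpoly F (ctot m ν s0 g) x| ≤ ∫ x in e, (|f x| + |wpoly F G x|) :=
          setIntegral_mono_on hiP (hif.add hiG) hem hpt
      _ = (∫ x in e, |f x|) + ∫ x in e, |wpoly F G x| := integral_add hif hiG
      _ < ε + ∫ x in e, |f x| := by linarith

lemma exists_params (ε : ℝ) (hε0 : 0 < ε) (C : ℝ) (hC : 0 < C) (M : ℕ) :
    ∃ m ν : ℕ, M ≤ m ∧ (2:ℝ) ^ m * (2 ^ m * 2 ^ ν * (C / 2 ^ m) ^ (2 + ε)) < ε ∧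
      (2:ℝ) ^ m * 2 ^ ν * (C / 2 ^ m) ^ 2 ≤ ε ^ 2 / 4 ∧ (1:ℝ) / 2 ^ ν < ε := by
  obtain ⟨ν, hν⟩ := exists_pow_lt_of_lt_one hε0 (by norm_num : (1/2:ℝ) < 1)
  have ht : Filter.Tendsto (fun m : ℕ => C / (2:ℝ) ^ m) Filter.atTop (nhds 0) := by
    have h := (tendsto_pow_atTop_nhds_zero_of_lt_one (by norm_num : (0:ℝ) ≤ 1/2)
      (by norm_num : (1/2:ℝ) < 1)).const_mul C
    rw [mul_zero] at h
    refine h.congr fun m => ?_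
    rw [div_pow, one_pow]; ring
  have ht1 : Filter.Tendsto (fun m : ℕ => 2 ^ ν * C ^ 2 * (C / (2:ℝ) ^ m) ^ ε)
      Filter.atTop (nhds 0) := by
    have h := ((ht.rpow_const (p := ε) (Or.inr hε0.le))).const_mul (2 ^ ν * C ^ 2)
    rwa [Real.zero_rpow hε0.ne', mul_zero] at h
  have ht2 : Filter.Tendsto (fun m : ℕ => 2 ^ ν * C * (C / (2:ℝ) ^ m))
      Filter.atTop (nhds 0) := by
    have h := ht.const_mul (2 ^ ν * C)
    rwa [mul_zero] at h
  obtain ⟨m, ⟨ha, hb⟩, hc⟩ := (((ht1.eventually_lt_const hε0).and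
    (ht2.eventually_lt_const (by positivity : 0 < ε ^ 2 / 4))).and
    (Filter.eventually_ge_atTop M)).exists
  refine ⟨m, ν, hc, ?_, ?_, ?_⟩
  · refine lt_of_eq_of_lt ?_ ha
    rw [Real.rpow_add (by positivity), Real.rpow_two]
    field_simp
  · refine le_trans (le_of_eq ?_) hb.le
    field_simp
  · rwa [div_pow, one_pow] at hν

lemma mem_Icc_floor (m M : ℕ) (hM : M ≤ m) (a : ℕ) (x : ℝ)
    (hx : ∀ n : ℤ, 2 ^ m * x ≠ n) :
    x ∈ Set.Icc (((a:ℝ) - 1) / 2 ^ M) ((a:ℝ) / 2 ^ M) ↔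
      ((a:ℤ) - 1) * 2 ^ (m - M) ≤ ⌊2 ^ m * x⌋ ∧ ⌊2 ^ m * x⌋ < (a:ℤ) * 2 ^ (m - M) := by
  have hpow : (2:ℝ) ^ m = 2 ^ (m - M) * 2 ^ M := by rw [← pow_add]; congr 1; omega
  have hp : (0:ℝ) < 2 ^ (m - M) := by positivity
  have hlt : ((2:ℝ) ^ m * x < ((a:ℤ) * 2 ^ (m - M) : ℤ)) ↔
      ((2:ℝ) ^ m * x ≤ ((a:ℤ) * 2 ^ (m - M) : ℤ)) :=
    ⟨le_of_lt, fun h => lt_of_le_of_ne h (hx _)⟩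
  rw [Int.le_floor, Int.floor_lt, hlt, Set.mem_Icc, div_le_iff₀ (by positivity),
    le_div_iff₀ (by positivity)]
  push_cast
  rw [hpow]
  constructor
  · rintro ⟨h1, h2⟩; constructor <;> nlinarith
  · rintro ⟨h1, h2⟩
    constructor
    · refine le_of_mul_le_mul_right ?_ hp; nlinarith
    · refine le_of_mul_le_mul_right ?_ hp; nlinarith

/-- Lemma 1: one-dimensional approximation of dyadic step functions by Walsh polynomials. -/
theorem lemma_one (ε : ℝ) (hε0 : 0 < ε) (hε1 : ε < 1) (N0 : ℕ) (hN0 : 2 < N0)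
    (q : ℕ) (γ : ℕ → ℝ) (m i : ℕ → ℕ) (hi : ∀ s < q, 1 ≤ i s ∧ i s ≤ 2 ^ m s) :
    ∃ (E : Set ℝ) (N : ℕ) (c : ℕ → ℝ),
      MeasurableSet E ∧ E ⊆ Set.Icc 0 1 ∧
      volume E > ENNReal.ofReal (1 - ε) ∧ N0 ≤ N ∧
      (∀ x ∈ E, ∑ k ∈ Finset.Icc N0 N, c k * walsh k x =
        ∑ s ∈ Finset.range q, γ s * Set.indicator
          (Set.Icc (((i s : ℝ) - 1) / 2 ^ m s) ((i s : ℝ) / 2 ^ m s)) (fun _ => (1:ℝ)) x) ∧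
      (∑ k ∈ Finset.Icc N0 N, |c k| ^ (2 + ε) < ε) ∧
      (∀ e ⊆ E, MeasurableSet e → ∀ n ∈ Finset.Ico N0 N,
        (∫ x in e, |∑ k ∈ Finset.Icc N0 n, c k * walsh k x|) <
          ε + ∫ x in e, |∑ s ∈ Finset.range q, γ s * Set.indicator
            (Set.Icc (((i s : ℝ) - 1) / 2 ^ m s) ((i s : ℝ) / 2 ^ m s)) (fun _ => (1:ℝ)) x|) := by
  set f : ℝ → ℝ := fun x => ∑ s ∈ Finset.range q, γ s * Set.indicator
          (Set.Icc (((i s : ℝ) - 1) / 2 ^ m s) ((i s : ℝ) / 2 ^ m s)) (fun _ => (1:ℝ)) x with hf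
  set C : ℝ := 1 + ∑ s ∈ Finset.range q, |γ s| with hC
  have hC0 : 0 < C := by
    have : 0 ≤ ∑ s ∈ Finset.range q, |γ s| := Finset.sum_nonneg fun _ _ => abs_nonneg _
    linarith
  have hfm : Measurable f := by
    apply Finset.measurable_fun_sum
    intro s _
    exact measurable_const.mul (measurable_const.indicator measurableSet_Icc)
  have hfC : ∀ x, |f x| ≤ C := by
    intro x
    have : |f x| ≤ ∑ s ∈ Finset.range q, |γ s| := by
      refine (Finset.abs_sum_le_sum_abs _ _).trans (Finset.sum_le_sum fun s _ => ?_)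
      rw [abs_mul]
      refine mul_le_of_le_one_right (abs_nonneg _) ?_
      unfold Set.indicator
      split_ifs <;> simp
    linarith
  obtain ⟨m', ν, hM, h1, h2, h3⟩ := exists_params ε hε0 C hC0 (∑ s ∈ Finset.range q, m s)
  have hms : ∀ s ∈ Finset.range q, m s ≤ m' := fun s hs =>
    (Finset.single_le_sum (f := m) (fun _ _ => Nat.zero_le _) hs).trans hM
  refine core ε hε0 hε1 N0 hN0 f hfm C hC0 hfC m' ν (fun j => f (((j:ℝ) + 1/2) / 2 ^ m'))
    (fun j => hfC _) ?_ h1 h2 h3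
  intro x hx hxZ j hj
  have hmul : (2:ℝ) ^ m' * (((j:ℝ) + 1/2) / 2 ^ m') = (j:ℝ) + 1/2 :=
    mul_div_cancel₀ _ (by positivity)
  have hfl : ⌊(2:ℝ) ^ m' * (((j:ℝ) + 1/2) / 2 ^ m')⌋ = (j:ℤ) := by
    rw [hmul, Int.floor_eq_iff]; push_cast; constructor <;> linarith
  have hyZ : ∀ n : ℤ, (2:ℝ) ^ m' * (((j:ℝ) + 1/2) / 2 ^ m') ≠ n := by
    intro n hn
    have h5 := hfl
    rw [hn, Int.floor_intCast] at h5
    rw [hmul, h5] at hn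
    push_cast at hn
    linarith
  simp only [hf]
  refine Finset.sum_congr rfl fun s hs => ?_
  congr 1
  have hiff : x ∈ Set.Icc (((i s : ℝ) - 1) / 2 ^ m s) ((i s : ℝ) / 2 ^ m s) ↔
      (((j:ℝ) + 1/2) / 2 ^ m') ∈ Set.Icc (((i s : ℝ) - 1) / 2 ^ m s) ((i s : ℝ) / 2 ^ m s) := by
    rw [mem_Icc_floor m' (m s) (hms s hs) (i s) x hxZ,
      mem_Icc_floor m' (m s) (hms s hs) (i s) _ hyZ, hj, hfl]
  by_cases hxs : x ∈ Set.Icc (((i s : ℝ) - 1) / 2 ^ m s) ((i s : ℝ) / 2 ^ m s)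
  · rw [Set.indicator_of_mem hxs, Set.indicator_of_mem (hiff.1 hxs)]
  · rw [Set.indicator_of_notMem hxs, Set.indicator_of_notMem (fun h => hxs (hiff.2 h))]
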